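/- arXiv:1610.08805 — 5 statements merged into one kernel-verified Lean document; each statement's English description precedes it below -/
import Mathlib

section
/- Fix k ∈ {1,2,3}. Let g_k : Ω → ℝ be σ(T,A)-measurable, integrable, and a version of Pr(D_k = 1 | V = 0, T, A), i.e., E[(1−V) D_k | σ(T,A)] = g_k · E[(1−V) | σ(T,A)] almost surely. Then the mean-score-imputation variable D_{k,MSI} = V D_k + (1−V) g_k satisfies E[D_{k,MSI} | σ(T,A)] = ρ_k almost surely. -/
open MeasureTheory ProbabilityTheory

lemma stmt3_aux {Ω : Type*} {m m0 : MeasurableSpace Ω} (P : Measure Ω) [IsProbabilityMeasure P]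
    (V D g : Ω → ℝ) (hV : Measurable V) (hD : Measurable D)
    (hD01 : ∀ ω, D ω = 0 ∨ D ω = 1) (hV01 : ∀ ω, V ω = 0 ∨ V ω = 1)
    (hgmeas : Measurable[m] g) (hgint : Integrable g P)
    (hg : P[fun ω => (1 - V ω) * D ω | m]
      =ᵐ[P] fun ω => g ω * (P[fun ω => 1 - V ω | m]) ω) :
    P[fun ω => V ω * D ω + (1 - V ω) * g ω | m] =ᵐ[P] P[D | m] := by
  have hW : Measurable (fun ω => 1 - V ω) := measurable_const.sub hV
  have hWb : ∀ ω, ‖1 - V ω‖ ≤ 1 := fun ω => by rcases hV01 ω with h | h <;> simp [h]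
  have iD : Integrable D P := Integrable.of_bound hD.aestronglyMeasurable 1
    (Filter.Eventually.of_forall fun ω => by rcases hD01 ω with h | h <;> simp [h])
  have iW : Integrable (fun ω => 1 - V ω) P := Integrable.of_bound hW.aestronglyMeasurable 1
    (Filter.Eventually.of_forall hWb)
  have iWD : Integrable (fun ω => (1 - V ω) * D ω) P :=
    iD.bdd_mul hW.aestronglyMeasurable (Filter.Eventually.of_forall hWb)
  have iWg : Integrable (fun ω => (1 - V ω) * g ω) P :=
    hgint.bdd_mul hW.aestronglyMeasurable (Filter.Eventually.of_forall hWb)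
  have e : (fun ω => V ω * D ω + (1 - V ω) * g ω)
      = (D - fun ω => (1 - V ω) * D ω) + fun ω => (1 - V ω) * g ω := by
    funext ω; simp only [Pi.add_apply, Pi.sub_apply]; ring
  have h1 := condExp_add (iD.sub iWD) iWg m
  have h2 := condExp_sub iD iWD m
  have h3 := condExp_mul_of_stronglyMeasurable_right (m := m) (f := fun ω => 1 - V ω)
    hgmeas.stronglyMeasurable iWg iW
  have h3' : P[fun ω => (1 - V ω) * g ω | m] =ᵐ[P] P[fun ω => 1 - V ω | m] * g := h3
  rw [e]
  filter_upwards [h1, h2, h3', hg] with ω a1 a2 a3 a4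
  rw [a1, Pi.add_apply, a2, Pi.sub_apply, a3, a4, Pi.mul_apply]
  ring

/-- If `g_k` is a `σ(T,A)`-measurable integrable version of
`Pr(D_k = 1 | V = 0, T, A)`, i.e. `E[(1−V) D_k | σ(T,A)] = g_k · E[(1−V) | σ(T,A)]` a.s., then
the mean-score-imputation variable `D_{k,MSI} = V D_k + (1−V) g_k` satisfies
`E[D_{k,MSI} | σ(T,A)] = ρ_k` a.s. -/
theorem stmt3 {Ω : Type*} [MeasurableSpace Ω] (P : Measure Ω) [IsProbabilityMeasure P]
    (T A V : Ω → ℝ) (D : Fin 3 → Ω → ℝ)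
    (hT : Measurable T) (hA : Measurable A) (hV : Measurable V)
    (hD : ∀ k, Measurable (D k))
    (hD01 : ∀ k ω, D k ω = 0 ∨ D k ω = 1)
    (hDsum : ∀ ω, D 0 ω + D 1 ω + D 2 ω = 1)
    (hV01 : ∀ ω, V ω = 0 ∨ V ω = 1)
    (m : MeasurableSpace Ω)
    (hm : m = MeasurableSpace.comap (fun ω => (T ω, A ω)) inferInstance)
    (k : Fin 3) (g : Ω → ℝ)
    (hgmeas : Measurable[m] g) (hgint : Integrable g P)
    (hg : P[fun ω => (1 - V ω) * D k ω | m]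
      =ᵐ[P] fun ω => g ω * (P[fun ω => 1 - V ω | m]) ω) :
    P[fun ω => V ω * D k ω + (1 - V ω) * g ω | m] =ᵐ[P] P[D k | m] := by
  exact stmt3_aux P V (D k) g hV (hD k) (hD01 k) hV01 hgmeas hgint hg
end

section
/- Fix k ∈ {1,2,3}. Let π be a version of E[V | σ(D1, D2, T, A)], assume π > 0 almost surely and that 1/π is integrable. Then the inverse-probability-weighted variable V D_k / π satisfies E[V D_k / π | σ(T,A)] = ρ_k almost surely. -/
open MeasureTheory ProbabilityTheory

theorem aux_ipw {Ω : Type*} {m m' m0 : MeasurableSpace Ω} (P : Measure[m0] Ω)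
    [IsProbabilityMeasure P] (V D π : Ω → ℝ)
    (hmm : m ≤ m') (hm' : m' ≤ m0) (hV : Measurable[m0] V) (hD : Measurable[m'] D)
    (hD01 : ∀ ω, D ω = 0 ∨ D ω = 1) (hV01 : ∀ ω, V ω = 0 ∨ V ω = 1)
    (hπ : π =ᵐ[P] P[V | m']) (hπpos : ∀ᵐ ω ∂P, 0 < π ω)
    (hπint : Integrable (fun ω => (π ω)⁻¹) P) :
    P[fun ω => V ω * D ω / π ω | m] =ᵐ[P] P[D | m] := by
  have hD0 : Measurable[m0] D := hD.mono hm' le_rfl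
  have hVi : Integrable V P := by
    refine Integrable.of_bound hV.aestronglyMeasurable 1 (Filter.Eventually.of_forall fun ω => ?_)
    rcases hV01 ω with h | h <;> simp [h]
  let f : Ω → ℝ := fun ω => D ω * ((P[V | m']) ω)⁻¹
  have hf : StronglyMeasurable[m'] f := by
    have h1 : Measurable[m'] (P[V | m']) := stronglyMeasurable_condExp.measurable
    exact (hD.mul h1.inv).stronglyMeasurable
  have hint : Integrable (f * V) P := by
    refine Integrable.mono hπint
      ((hf.mono hm').aestronglyMeasurable.mul hV.aestronglyMeasurable) ?_
    filter_upwards [hπ] with ω h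
    rcases hV01 ω with hv | hv <;> rcases hD01 ω with hd | hd <;> simp [f, hv, hd, h]
  have e1 : (fun ω => V ω * D ω / π ω) =ᵐ[P] f * V := by
    filter_upwards [hπ] with ω h
    simp only [f, Pi.mul_apply, h]
    ring
  have e2 : P[f * V | m'] =ᵐ[P] D := by
    filter_upwards [condExp_mul_of_stronglyMeasurable_left hf hint hVi, hπ, hπpos] with ω h h1 h2
    rw [h1] at h2
    rw [h]
    simp only [f, Pi.mul_apply]
    field_simp
  exact (condExp_congr_ae e1).trans
    ((condExp_condExp_of_le hmm hm').symm.trans (condExp_congr_ae e2))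

/-- If `π` is a version of `E[V | σ(D1,D2,T,A)]` with `π > 0` a.s. and `1/π`
integrable, then the inverse-probability-weighted variable `V D_k / π` satisfies
`E[V D_k / π | σ(T,A)] = ρ_k` a.s. -/
theorem stmt4 {Ω : Type*} [MeasurableSpace Ω] (P : Measure Ω) [IsProbabilityMeasure P]
    (T A V : Ω → ℝ) (D : Fin 3 → Ω → ℝ)
    (hT : Measurable T) (hA : Measurable A) (hV : Measurable V)
    (hD : ∀ k, Measurable (D k))
    (hD01 : ∀ k ω, D k ω = 0 ∨ D k ω = 1)
    (hDsum : ∀ ω, D 0 ω + D 1 ω + D 2 ω = 1)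
    (hV01 : ∀ ω, V ω = 0 ∨ V ω = 1)
    (m : MeasurableSpace Ω)
    (hm : m = MeasurableSpace.comap (fun ω => (T ω, A ω)) inferInstance)
    (k : Fin 3) (π : Ω → ℝ)
    (hπ : π =ᵐ[P]
      P[V | MeasurableSpace.comap (fun ω => (D 0 ω, D 1 ω, T ω, A ω)) inferInstance])
    (hπpos : ∀ᵐ ω ∂P, 0 < π ω)
    (hπint : Integrable (fun ω => (π ω)⁻¹) P) :
    P[fun ω => V ω * D k ω / π ω | m] =ᵐ[P] P[D k | m] := by
  subst hm
  refine aux_ipw P V (D k) π ?_ ?_ hV ?_ (hD01 k) hV01 hπ hπpos hπint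
  · rintro s ⟨t, ht, rfl⟩
    exact ⟨(fun p : ℝ × ℝ × ℝ × ℝ => p.2.2) ⁻¹' t, (by fun_prop : Measurable
      (fun p : ℝ × ℝ × ℝ × ℝ => p.2.2)) ht, rfl⟩
  · exact ((hD 0).prodMk ((hD 1).prodMk (hT.prodMk hA))).comap_le
  · have key : ∀ g : ℝ × ℝ × ℝ × ℝ → ℝ, Measurable g →
        D k = g ∘ (fun ω => (D 0 ω, D 1 ω, T ω, A ω)) →
        Measurable[MeasurableSpace.comap (fun ω => (D 0 ω, D 1 ω, T ω, A ω)) inferInstance]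
          (D k) := by
      intro g hg h
      rw [h]
      exact hg.comp (comap_measurable _)
    fin_cases k
    · exact key (fun p => p.1) (by fun_prop) rfl
    · exact key (fun p => p.2.1) (by fun_prop) rfl
    · refine key (fun p => 1 - p.1 - p.2.1) (by fun_prop) ?_
      funext ω
      have := hDsum ω
      simp only [Function.comp]
      change D 2 ω = _
      linarith
end

section
/- Fix k ∈ {1,2,3}. Let π be a version of E[V | σ(D1, D2, T, A)] with π > 0 almost surely and 1/π integrable, and let g_k : Ω → ℝ be σ(T,A)-measurable, integrable with g_k/π integrable, and a version of Pr(D_k = 1 | V = 0, T, A), i.e., E[(1−V) D_k | σ(T,A)] = g_k · E[(1−V) | σ(T,A)] almost surely. Then the pseudo-doubly-robust variable D_{k,PDR} = V D_k / π − g_k (V/π − 1) satisfies E[D_{k,PDR} | σ(T,A)] = ρ_k almost surely. -/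
open MeasureTheory ProbabilityTheory

theorem stmt5_aux {Ω : Type*} {m m' m0 : MeasurableSpace Ω} (P : Measure Ω)
    [IsProbabilityMeasure P] (hmm : m ≤ m') (hm' : m' ≤ m0)
    (V d π g : Ω → ℝ) (hV : Measurable[m0] V) (hd : Measurable[m'] d)
    (hd01 : ∀ ω, d ω = 0 ∨ d ω = 1) (hV01 : ∀ ω, V ω = 0 ∨ V ω = 1)
    (hπ : π =ᵐ[P] P[V | m'])
    (hπpos : ∀ᵐ ω ∂P, 0 < π ω)
    (hπint : Integrable (fun ω => (π ω)⁻¹) P)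
    (hgmeas : Measurable[m] g) (hgint : Integrable g P)
    (hgπint : Integrable (fun ω => g ω / π ω) P) :
    P[fun ω => V ω * d ω / π ω - g ω * (V ω / π ω - 1) | m] =ᵐ[P] P[d | m] := by
  have hVb : ∀ ω, ‖V ω‖ ≤ 1 := fun ω => by rcases hV01 ω with h | h <;> simp [h]
  have hdb : ∀ ω, ‖d ω‖ ≤ 1 := fun ω => by rcases hd01 ω with h | h <;> simp [h]
  have hd0 : Measurable[m0] d := hd.mono hm' le_rfl
  have hVint : Integrable V P :=
    Integrable.of_bound hV.aestronglyMeasurable 1 (ae_of_all _ hVb)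
  have hdint : Integrable d P :=
    Integrable.of_bound hd0.aestronglyMeasurable 1 (ae_of_all _ hdb)
  have hg' : Measurable[m'] g := hgmeas.mono hmm le_rfl
  have hq : Measurable[m'] (P[V | m']) := stronglyMeasurable_condExp.measurable
  have hw : Measurable[m'] (fun ω => (d ω - g ω) / (P[V | m']) ω) :=
    Measurable.div (Measurable.sub hd hg') hq
  have hdπ : Integrable (fun ω => d ω * (π ω)⁻¹) P :=
    hπint.bdd_mul hd0.aestronglyMeasurable (ae_of_all _ hdb)
  have hwint : Integrable (fun ω => (d ω - g ω) / (P[V | m']) ω) P := by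
    refine (hdπ.sub hgπint).congr ?_
    filter_upwards [hπ] with ω h
    simp only [Pi.sub_apply]
    rw [← h]; ring
  have hwV : Integrable ((fun ω => (d ω - g ω) / (P[V | m']) ω) * V) P := by
    refine (hwint.bdd_mul hV.aestronglyMeasurable (ae_of_all _ hVb)).congr ?_
    filter_upwards with ω
    simp only [Pi.mul_apply]; ring
  have h1 := condExp_mul_of_stronglyMeasurable_left (μ := P) hw.stronglyMeasurable hwV hVint
  have h2 : (fun ω => V ω * d ω / π ω - g ω * (V ω / π ω - 1)) =ᵐ[P]
      (fun ω => (d ω - g ω) / (P[V | m']) ω) * V + g := by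
    filter_upwards [hπ] with ω h
    simp only [Pi.mul_apply, Pi.add_apply]
    rw [← h]; ring
  have h3 : P[fun ω => V ω * d ω / π ω - g ω * (V ω / π ω - 1) | m'] =ᵐ[P] d := by
    have h4 := condExp_add hwV hgint m'
    have h5 : P[g | m'] = g := condExp_of_stronglyMeasurable hm' hg'.stronglyMeasurable hgint
    filter_upwards [condExp_congr_ae (m := m') h2, h4, h1, hπ, hπpos] with ω a b c e f
    rw [a, b, Pi.add_apply, c, h5, Pi.mul_apply, ← e]
    field_simp
    ring
  exact (condExp_condExp_of_le hmm hm').symm.trans (condExp_congr_ae h3)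

theorem stmt5_aux2 {Ω : Type*} {m : MeasurableSpace Ω} {a b : Ω → ℝ}
    (ha : Measurable a) (hb : Measurable b) : Measurable (fun ω => 1 - a ω - b ω) :=
  (measurable_const.sub ha).sub hb

/-- If `π` is a version of `E[V | σ(D1,D2,T,A)]` with `π > 0` a.s. and `1/π`
integrable, and `g_k` is a `σ(T,A)`-measurable integrable version of `Pr(D_k = 1 | V = 0, T, A)`
with `g_k/π` integrable, then the pseudo-doubly-robust variable
`D_{k,PDR} = V D_k / π − g_k (V/π − 1)` satisfies `E[D_{k,PDR} | σ(T,A)] = ρ_k` a.s. -/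
theorem stmt5 {Ω : Type*} [MeasurableSpace Ω] (P : Measure Ω) [IsProbabilityMeasure P]
    (T A V : Ω → ℝ) (D : Fin 3 → Ω → ℝ)
    (hT : Measurable T) (hA : Measurable A) (hV : Measurable V)
    (hD : ∀ k, Measurable (D k))
    (hD01 : ∀ k ω, D k ω = 0 ∨ D k ω = 1)
    (hDsum : ∀ ω, D 0 ω + D 1 ω + D 2 ω = 1)
    (hV01 : ∀ ω, V ω = 0 ∨ V ω = 1)
    (m : MeasurableSpace Ω)
    (hm : m = MeasurableSpace.comap (fun ω => (T ω, A ω)) inferInstance)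
    (k : Fin 3) (π g : Ω → ℝ)
    (hπ : π =ᵐ[P]
      P[V | MeasurableSpace.comap (fun ω => (D 0 ω, D 1 ω, T ω, A ω)) inferInstance])
    (hπpos : ∀ᵐ ω ∂P, 0 < π ω)
    (hπint : Integrable (fun ω => (π ω)⁻¹) P)
    (hgmeas : Measurable[m] g) (hgint : Integrable g P)
    (hgπint : Integrable (fun ω => g ω / π ω) P)
    (hg : P[fun ω => (1 - V ω) * D k ω | m]
      =ᵐ[P] fun ω => g ω * (P[fun ω => 1 - V ω | m]) ω) :
    P[fun ω => V ω * D k ω / π ω - g ω * (V ω / π ω - 1) | m] =ᵐ[P] P[D k | m] := by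
  have hF : Measurable[MeasurableSpace.comap (fun ω => (D 0 ω, D 1 ω, T ω, A ω)) inferInstance]
      (fun ω => (D 0 ω, D 1 ω, T ω, A ω)) := fun s hs => ⟨s, hs, rfl⟩
  refine stmt5_aux P ?_ ?_ V (D k) π g hV ?_ (hD01 k) hV01 hπ hπpos hπint hgmeas hgint hgπint
  · rw [hm]
    exact Measurable.comap_le (measurable_snd.comp (measurable_snd.comp hF))
  · exact Measurable.comap_le
      ((hD 0).prodMk ((hD 1).prodMk (hT.prodMk hA)))
  · have h0 := measurable_fst.comp hF
    have h1 := measurable_fst.comp (measurable_snd.comp hF)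
    fin_cases k
    · exact h0
    · exact h1
    · have : D 2 = fun ω => 1 - D 0 ω - D 1 ω := by
        funext ω; linarith [hDsum ω]
      have h2 := stmt5_aux2 h0 h1
      exact this ▸ h2
end

section
/- Suppose E[V | σ(D1, D2, T, A)] = π10 D1 + π01 D2 + π00 D3 almost surely, where π10, π01, π00 are σ(T,A)-measurable random variables with values in [0,1], and suppose z = (1−π10) ρ1 + (1−π01) ρ2 + (1−π00) ρ3 > 0 almost surely. Then the σ(T,A)-measurable variables g_1 = (1−π10) ρ1 / z, g_2 = (1−π01) ρ2 / z, g_3 = (1−π00) ρ3 / z are versions of Pr(D_k = 1 | V = 0, T, A): for each k = 1,2,3, E[(1−V) D_k | σ(T,A)] = g_k · E[(1−V) | σ(T,A)] almost surely. -/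
open MeasureTheory ProbabilityTheory

theorem aux_key {Ω : Type*} {m m2 mΩ : MeasurableSpace Ω} (P : Measure Ω)
    [IsProbabilityMeasure P] (hm : m ≤ m2) (hm2 : m2 ≤ mΩ)
    (V d p q : Ω → ℝ) (hV : Integrable V P) (hd : Measurable[m2] d)
    (hd01 : ∀ ω, d ω = 0 ∨ d ω = 1)
    (hp : Measurable[m] p) (hp01 : ∀ ω, p ω ∈ Set.Icc (0:ℝ) 1)
    (hver : P[V | m2] =ᵐ[P] q) (hq : ∀ ω, (1 - q ω) * d ω = (1 - p ω) * d ω) :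
    P[fun ω => (1 - V ω) * d ω | m] =ᵐ[P] fun ω => (1 - p ω) * (P[d | m]) ω := by
  have hdb : ∀ ω, ‖d ω‖ ≤ 1 := by
    intro ω; rcases hd01 ω with h | h <;> simp [h]
  have hdi : Integrable d P :=
    Integrable.of_bound ((hd.mono hm2 le_rfl).aestronglyMeasurable) 1 (ae_of_all _ hdb)
  have h1V : Integrable (fun ω => 1 - V ω) P := (integrable_const 1).sub hV
  have e0 : P[fun ω => 1 - V ω | m2] =ᵐ[P] fun ω => 1 - q ω := by
    have h := condExp_sub (μ := P) (integrable_const (1:ℝ)) hV m2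
    rw [condExp_const hm2] at h
    filter_upwards [h, hver] with ω h1 h2
    simp only [Pi.sub_apply, h2] at h1
    exact h1
  have e1 : P[fun ω => (1 - V ω) * d ω | m2] =ᵐ[P] fun ω => (1 - p ω) * d ω := by
    have h := condExp_stronglyMeasurable_mul_of_bound hm2 (μ := P) hd.stronglyMeasurable h1V 1
      (ae_of_all _ hdb)
    have e : (d * fun ω => 1 - V ω) = fun ω => (1 - V ω) * d ω := by
      ext ω; simp [mul_comm]
    rw [e] at h
    filter_upwards [h, e0] with ω h1 h2
    rw [h1, Pi.mul_apply, h2, mul_comm, hq]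
  have e2 := condExp_condExp_of_le (μ := P) (f := fun ω => (1 - V ω) * d ω) hm hm2
  have e3 := condExp_congr_ae (m := m) e1
  have e4 := condExp_stronglyMeasurable_mul_of_bound (hm.trans hm2) (μ := P)
    (f := fun ω => 1 - p ω) (hp.const_sub 1).stronglyMeasurable hdi 1
    (ae_of_all _ fun ω => by
      rw [Real.norm_eq_abs, abs_le]; constructor <;> linarith [(hp01 ω).1, (hp01 ω).2])
  exact e2.symm.trans (e3.trans e4)

/-- If `E[V | σ(D1,D2,T,A)] = π10 D1 + π01 D2 + π00 D3` a.s. with `π10, π01, π00`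
`σ(T,A)`-measurable `[0,1]`-valued, and `z = (1−π10)ρ1 + (1−π01)ρ2 + (1−π00)ρ3 > 0` a.s., then
the `σ(T,A)`-measurable variables `g_k = (1−π_k) ρ_k / z` are versions of
`Pr(D_k = 1 | V = 0, T, A)`: for each `k`,
`E[(1−V) D_k | σ(T,A)] = g_k · E[(1−V) | σ(T,A)]` a.s. -/
theorem stmt11 {Ω : Type*} [MeasurableSpace Ω] (P : Measure Ω) [IsProbabilityMeasure P]
    (T A V : Ω → ℝ) (D : Fin 3 → Ω → ℝ)
    (hT : Measurable T) (hA : Measurable A) (hV : Measurable V)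
    (hD : ∀ k, Measurable (D k))
    (hD01 : ∀ k ω, D k ω = 0 ∨ D k ω = 1)
    (hDsum : ∀ ω, D 0 ω + D 1 ω + D 2 ω = 1)
    (hV01 : ∀ ω, V ω = 0 ∨ V ω = 1)
    (m : MeasurableSpace Ω)
    (hm : m = MeasurableSpace.comap (fun ω => (T ω, A ω)) inferInstance)
    (πv : Fin 3 → Ω → ℝ)
    (hπmeas : ∀ k, Measurable[m] (πv k))
    (hπ01 : ∀ k ω, πv k ω ∈ Set.Icc (0:ℝ) 1)
    (hver : P[V | MeasurableSpace.comap (fun ω => (D 0 ω, D 1 ω, T ω, A ω)) inferInstance]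
      =ᵐ[P] fun ω => πv 0 ω * D 0 ω + πv 1 ω * D 1 ω + πv 2 ω * D 2 ω)
    (z : Ω → ℝ)
    (hz : z = fun ω => (1 - πv 0 ω) * (P[D 0 | m]) ω + (1 - πv 1 ω) * (P[D 1 | m]) ω
      + (1 - πv 2 ω) * (P[D 2 | m]) ω)
    (hzpos : ∀ᵐ ω ∂P, 0 < z ω) :
    ∀ k : Fin 3, P[fun ω => (1 - V ω) * D k ω | m]
      =ᵐ[P] fun ω => ((1 - πv k ω) * (P[D k | m]) ω / z ω) * (P[fun ω => 1 - V ω | m]) ω := by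
  have hVi : Integrable V P := by
    refine Integrable.of_bound hV.aestronglyMeasurable 1 (ae_of_all _ fun ω => ?_)
    rcases hV01 ω with h | h <;> simp [h]
  have hm2 := ((hD 0).prodMk ((hD 1).prodMk (hT.prodMk hA))).comap_le
  have hc := comap_measurable (m := (inferInstance : MeasurableSpace (ℝ × ℝ × ℝ × ℝ)))
    (fun ω => (D 0 ω, D 1 ω, T ω, A ω))
  have hmm : m ≤ MeasurableSpace.comap (fun ω => (D 0 ω, D 1 ω, T ω, A ω)) inferInstance := by
    rw [hm]
    exact (measurable_snd.comp (measurable_snd.comp hc)).comap_le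
  have hd0 := measurable_fst.comp hc
  have hd1 := measurable_fst.comp (measurable_snd.comp hc)
  have hd2 : Measurable[MeasurableSpace.comap (fun ω => (D 0 ω, D 1 ω, T ω, A ω)) inferInstance]
      (D 2) := by
    have e : D 2 = fun ω => 1 - D 0 ω - D 1 ω := by
      ext ω; linarith [hDsum ω]
    rw [e]
    exact (hd0.const_sub 1).sub hd1
  have hq : ∀ k ω, (1 - (πv 0 ω * D 0 ω + πv 1 ω * D 1 ω + πv 2 ω * D 2 ω)) * D k ω
      = (1 - πv k ω) * D k ω := by
    intro k ω
    have hs := hDsum ω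
    rcases hD01 0 ω with h0 | h0 <;> rcases hD01 1 ω with h1 | h1 <;>
      rcases hD01 2 ω with h2 | h2 <;> rw [h0, h1, h2] at hs <;> norm_num at hs <;>
      fin_cases k <;> simp [h0, h1, h2]
  have key : ∀ k, P[fun ω => (1 - V ω) * D k ω | m]
      =ᵐ[P] fun ω => (1 - πv k ω) * (P[D k | m]) ω := by
    intro k
    refine aux_key P hmm hm2 V (D k) (πv k) _ hVi ?_ (hD01 k) (hπmeas k) (hπ01 k) hver (hq k)
    fin_cases k
    · exact hd0
    · exact hd1
    · exact hd2
  have hi : ∀ k, Integrable (fun ω => (1 - V ω) * D k ω) P := by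
    intro k
    refine Integrable.of_bound ((hV.const_sub 1).mul (hD k)).aestronglyMeasurable 1
      (ae_of_all _ fun ω => ?_)
    rcases hV01 ω with h | h <;> rcases hD01 k ω with h' | h' <;> simp [h, h']
  have hsum : P[fun ω => 1 - V ω | m] =ᵐ[P] z := by
    have e : (fun ω => 1 - V ω) = ((fun ω => (1 - V ω) * D 0 ω) + fun ω => (1 - V ω) * D 1 ω)
        + fun ω => (1 - V ω) * D 2 ω := by
      ext ω
      simp only [Pi.add_apply]
      rw [← mul_add, ← mul_add, hDsum, mul_one]
    rw [e]
    filter_upwards [condExp_add ((hi 0).add (hi 1)) (hi 2) m, condExp_add (hi 0) (hi 1) m,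
      key 0, key 1, key 2] with ω a b c d f
    rw [a, Pi.add_apply, b, Pi.add_apply, c, d, f, hz]
  intro k
  filter_upwards [key k, hsum, hzpos] with ω a b c
  rw [a, b, div_mul_cancel₀ _ c.ne']
end

section
/- (Consistency, abstract form of Theorem 1.) Let d ∈ ℕ, ξ0 ∈ ℝ^d, μ0 ∈ [0,1], and let e : ℝ × ℝ^d → ℝ be continuously differentiable with e(μ0, ξ0) = 0, ∂e/∂μ(μ0, ξ0) ≠ 0, and such that μ0 is the unique zero of μ ↦ e(μ, ξ0) on [0,1]. For each n, let G_n : Ω × ℝ × ℝ^d → ℝ be jointly measurable and continuous in (μ, ξ), and let μ̂_n : Ω → [0,1] and ξ̂_n : Ω → ℝ^d be random variables with G_n(ω, μ̂_n(ω), ξ̂_n(ω)) = 0 for all ω. Assume ξ̂_n → ξ0 in probability and, for every compact K ⊆ ℝ × ℝ^d, sup_{(μ,ξ)∈K} |G_n(·, μ, ξ) − e(μ, ξ)| → 0 in probability. Then μ̂_n → μ0 in probability. -/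
open MeasureTheory Filter

/-- Consistency, abstract form of Theorem 1: with `e` continuously
differentiable, `e(μ0, ξ0) = 0`, `∂e/∂μ(μ0,ξ0) ≠ 0`, `μ0` the unique zero of `e(·, ξ0)` on
`[0,1]`, `G_n` jointly measurable and continuous in `(μ,ξ)`, `μ̂_n, ξ̂_n` random with
`G_n(ω, μ̂_n(ω), ξ̂_n(ω)) = 0`, `ξ̂_n → ξ0` in probability and
`sup_K |G_n − e| → 0` in probability for every compact `K`, one has `μ̂_n → μ0`
in probability. -/
theorem stmt15 {Ω : Type*} [MeasurableSpace Ω] (P : Measure Ω) [IsProbabilityMeasure P]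
    (d : ℕ) (ξ0 : Fin d → ℝ) (μ0 : ℝ) (hμ0mem : μ0 ∈ Set.Icc (0:ℝ) 1)
    (e : ℝ × (Fin d → ℝ) → ℝ)
    (he : ContDiff ℝ 1 e)
    (hzero : e (μ0, ξ0) = 0)
    (hderiv : deriv (fun μ => e (μ, ξ0)) μ0 ≠ 0)
    (huniq : ∀ μ ∈ Set.Icc (0:ℝ) 1, e (μ, ξ0) = 0 → μ = μ0)
    (G : ℕ → Ω × (ℝ × (Fin d → ℝ)) → ℝ)
    (hGmeas : ∀ n, Measurable (G n))
    (hGcont : ∀ n ω, Continuous (fun p : ℝ × (Fin d → ℝ) => G n (ω, p)))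
    (μhat : ℕ → Ω → ℝ) (ξhat : ℕ → Ω → Fin d → ℝ)
    (hμhatmeas : ∀ n, Measurable (μhat n))
    (hμhatmem : ∀ n ω, μhat n ω ∈ Set.Icc (0:ℝ) 1)
    (hξhatmeas : ∀ n, Measurable (ξhat n))
    (hroot : ∀ n ω, G n (ω, (μhat n ω, ξhat n ω)) = 0)
    (hξconv : TendstoInMeasure P ξhat atTop (fun _ => ξ0))
    (hunif : ∀ K : Set (ℝ × (Fin d → ℝ)), IsCompact K →
      TendstoInMeasure P
        (fun n ω => ⨆ p : K, |G n (ω, (p : ℝ × (Fin d → ℝ))) - e (p : ℝ × (Fin d → ℝ))|)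
        atTop (fun _ => (0:ℝ))) :
    TendstoInMeasure P μhat atTop (fun _ => μ0) := by
  rw [tendstoInMeasure_iff_dist] at hξconv ⊢
  intro ε hε
  have hK : IsCompact (Set.Icc (0:ℝ) 1 ×ˢ Metric.closedBall ξ0 1) :=
    isCompact_Icc.prod (isCompact_closedBall ξ0 1)
  set K : Set (ℝ × (Fin d → ℝ)) := Set.Icc (0:ℝ) 1 ×ˢ Metric.closedBall ξ0 1 with hKdef
  have hC : IsCompact (K ∩ {p | ε ≤ dist p.1 μ0}) :=
    hK.inter_right (isClosed_le continuous_const (by fun_prop))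
  have hec : Continuous e := he.continuous
  have hfc : Continuous (fun p : ℝ × (Fin d → ℝ) => max |e p| (dist p.2 ξ0)) := by fun_prop
  obtain ⟨c, hc, hcle⟩ := hC.exists_forall_le' (a := (0:ℝ)) hfc.continuousOn (by
    rintro ⟨m, x⟩ ⟨⟨hm, _⟩, hd⟩
    by_contra hcon
    have h2 := not_lt.mp hcon
    have h3 : |e (m, x)| ≤ 0 := (le_max_left _ _).trans h2
    have h4 : dist x ξ0 ≤ 0 := (le_max_right _ _).trans h2
    have h5 : x = ξ0 := dist_le_zero.mp h4
    subst h5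
    have h6 := huniq m hm (abs_nonpos_iff.mp h3)
    subst h6
    simp at hd
    linarith)
  have hU := hunif K hK
  rw [tendstoInMeasure_iff_dist] at hU
  have h1 := hξconv (min c 1) (lt_min hc one_pos)
  have h2 := hU c hc
  have h3 := h1.add h2
  rw [add_zero] at h3
  refine tendsto_of_tendsto_of_tendsto_of_le_of_le tendsto_const_nhds h3
    (fun _ => zero_le) (fun n => ?_)
  refine (measure_mono ?_).trans (measure_union_le _ _)
  intro ω hω
  by_contra hcon
  simp only [Set.mem_union, Set.mem_setOf_eq, not_or, not_le] at hcon hω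
  obtain ⟨ha, hb⟩ := hcon
  have hmem : (μhat n ω, ξhat n ω) ∈ K :=
    ⟨hμhatmem n ω, Metric.mem_closedBall.mpr (ha.le.trans (min_le_right _ _))⟩
  have hbd : BddAbove (Set.range fun p : K =>
      |G n (ω, (p : ℝ × (Fin d → ℝ))) - e (p : ℝ × (Fin d → ℝ))|) := by
    have := (hK.image ((hGcont n ω).sub hec).abs).bddAbove
    rwa [Set.image_eq_range] at this
  have hle := le_ciSup hbd ⟨_, hmem⟩
  simp only [hroot, zero_sub, abs_neg] at hle
  rw [Real.dist_0_eq_abs] at hb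
  have hlt := hle.trans_lt ((le_abs_self _).trans_lt hb)
  have := hcle _ ⟨hmem, hω⟩
  exact absurd this (not_le.mpr (max_lt hlt (ha.trans_le (min_le_left _ _))))
end
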